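/- Let k be a field and let q ∈ k be nonzero. There exists a k-algebra homomorphism α : GL_q(2,-2) → GL_q(2) ⊗ GL_q(2,-2) with α(z_{ij}) = Σ_k x_{ik} ⊗ z_{kj} (for 1 ≤ i,j ≤ 2) and α(τ) = t ⊗ τ, and α makes GL_q(2,-2) a left GL_q(2)-comodule algebra: (Δ ⊗ id) ∘ α = (id ⊗ α) ∘ α and (ε ⊗ id) ∘ α = id, where Δ and ε are the comultiplication and counit of GL_q(2) determined by Δ(x_{ij}) = Σ_k x_{ik} ⊗ x_{kj}, Δ(t) = t ⊗ t, ε(x_{ij}) = δ_{ij}, ε(t) = 1. -/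

import Mathlib

open TensorProduct

/-- The five generators `x11, x12, x21, x22, t` of the algebra `GL_q(2)`. -/
inductive XGen : Type
  | x11 | x12 | x21 | x22 | t

/-- The five generators `z11, z12, z21, z22, τ` of the algebra `GL_q(2,-2)`. -/
inductive ZGen : Type
  | z11 | z12 | z21 | z22 | tau

noncomputable section

def Xf (k : Type) [Field k] : XGen → FreeAlgebra k XGen := FreeAlgebra.ι k
def Zf (k : Type) [Field k] : ZGen → FreeAlgebra k ZGen := FreeAlgebra.ι k

/-- The defining relations of `GL_q(2)`. -/
inductive GLq2Rel (k : Type) [Field k] (q : k) :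
    FreeAlgebra k XGen → FreeAlgebra k XGen → Prop
  | r1 : GLq2Rel k q (Xf k .x12 * Xf k .x11) (q • (Xf k .x11 * Xf k .x12))
  | r2 : GLq2Rel k q (Xf k .x21 * Xf k .x11) (q • (Xf k .x11 * Xf k .x21))
  | r3 : GLq2Rel k q (Xf k .x22 * Xf k .x12) (q • (Xf k .x12 * Xf k .x22))
  | r4 : GLq2Rel k q (Xf k .x22 * Xf k .x21) (q • (Xf k .x21 * Xf k .x22))
  | r5 : GLq2Rel k q (Xf k .x12 * Xf k .x21) (Xf k .x21 * Xf k .x12)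
  | r6 : GLq2Rel k q (Xf k .x11 * Xf k .x22 - Xf k .x22 * Xf k .x11)
      ((q⁻¹ - q) • (Xf k .x12 * Xf k .x21))
  | r7 : GLq2Rel k q (Xf k .x11 * Xf k .t) (Xf k .t * Xf k .x11)
  | r8 : GLq2Rel k q (Xf k .x22 * Xf k .t) (Xf k .t * Xf k .x22)
  | r9 : GLq2Rel k q (Xf k .x12 * Xf k .t) (Xf k .t * Xf k .x12)
  | r10 : GLq2Rel k q (Xf k .x21 * Xf k .t) (Xf k .t * Xf k .x21)
  | r11 : GLq2Rel k q ((Xf k .x11 * Xf k .x22 - q⁻¹ • (Xf k .x12 * Xf k .x21)) * Xf k .t) 1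

/-- The defining relations of `GL_q(2,-2)`. -/
inductive GLq22Rel (k : Type) [Field k] (q : k) :
    FreeAlgebra k ZGen → FreeAlgebra k ZGen → Prop
  | r1 : GLq22Rel k q (Zf k .z12 * Zf k .z11) (-(q • (Zf k .z11 * Zf k .z12)))
  | r2 : GLq22Rel k q (Zf k .z21 * Zf k .z11) (q • (Zf k .z11 * Zf k .z21))
  | r3 : GLq22Rel k q (Zf k .z22 * Zf k .z12) (q • (Zf k .z12 * Zf k .z22))
  | r4 : GLq22Rel k q (Zf k .z22 * Zf k .z21) (-(q • (Zf k .z21 * Zf k .z22)))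
  | r5 : GLq22Rel k q (Zf k .z12 * Zf k .z21) (-(Zf k .z21 * Zf k .z12))
  | r6 : GLq22Rel k q (Zf k .z11 * Zf k .z22 + Zf k .z22 * Zf k .z11)
      ((q - q⁻¹) • (Zf k .z12 * Zf k .z21))
  | r7 : GLq22Rel k q (Zf k .z11 * Zf k .tau) (-(Zf k .tau * Zf k .z11))
  | r8 : GLq22Rel k q (Zf k .z22 * Zf k .tau) (-(Zf k .tau * Zf k .z22))
  | r9 : GLq22Rel k q (Zf k .z12 * Zf k .tau) (-(Zf k .tau * Zf k .z12))
  | r10 : GLq22Rel k q (Zf k .z21 * Zf k .tau) (-(Zf k .tau * Zf k .z21))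
  | r11 : GLq22Rel k q ((Zf k .z11 * Zf k .z22 + q⁻¹ • (Zf k .z12 * Zf k .z21)) * Zf k .tau) 1

/-- The algebra `GL_q(2)`. -/
abbrev GLq2 (k : Type) [Field k] (q : k) := RingQuot (GLq2Rel k q)

/-- The algebra `GL_q(2,-2)`. -/
abbrev GLq22 (k : Type) [Field k] (q : k) := RingQuot (GLq22Rel k q)

variable (k : Type) [Field k] (q : k)

/-- The generating matrix entries `x_{ij}` (1 ≤ i,j ≤ 2) of `GL_q(2)`. -/
def xM : Fin 2 → Fin 2 → GLq2 k q :=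
  ![![RingQuot.mkAlgHom k (GLq2Rel k q) (Xf k .x11),
     RingQuot.mkAlgHom k (GLq2Rel k q) (Xf k .x12)],
    ![RingQuot.mkAlgHom k (GLq2Rel k q) (Xf k .x21),
     RingQuot.mkAlgHom k (GLq2Rel k q) (Xf k .x22)]]

/-- The element `t` of `GL_q(2)`. -/
def tE : GLq2 k q := RingQuot.mkAlgHom k (GLq2Rel k q) (Xf k .t)

/-- The generating matrix entries `z_{ij}` (1 ≤ i,j ≤ 2) of `GL_q(2,-2)`. -/
def zM : Fin 2 → Fin 2 → GLq22 k q :=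
  ![![RingQuot.mkAlgHom k (GLq22Rel k q) (Zf k .z11),
     RingQuot.mkAlgHom k (GLq22Rel k q) (Zf k .z12)],
    ![RingQuot.mkAlgHom k (GLq22Rel k q) (Zf k .z21),
     RingQuot.mkAlgHom k (GLq22Rel k q) (Zf k .z22)]]

/-- The element `τ` of `GL_q(2,-2)`. -/
def tauE : GLq22 k q := RingQuot.mkAlgHom k (GLq22Rel k q) (Zf k .tau)

section Points

variable {k : Type} [Field k] {q : k}
variable {A B : Type*} [Ring A] [Algebra k A] [Ring B] [Algebra k B]

/-- A matrix `x` and an element `t` of a `k`-algebra satisfying the defining relations of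
`GL_q(2)`. -/
structure IsGLq2Point (q : k) (x : Fin 2 → Fin 2 → A) (t : A) : Prop where
  row₀ : x 0 1 * x 0 0 = q • (x 0 0 * x 0 1)
  col₀ : x 1 0 * x 0 0 = q • (x 0 0 * x 1 0)
  col₁ : x 1 1 * x 0 1 = q • (x 0 1 * x 1 1)
  row₁ : x 1 1 * x 1 0 = q • (x 1 0 * x 1 1)
  antidiag : x 0 1 * x 1 0 = x 1 0 * x 0 1
  diag : x 0 0 * x 1 1 - x 1 1 * x 0 0 = (q⁻¹ - q) • (x 0 1 * x 1 0)
  comm : ∀ i j, x i j * t = t * x i j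
  det : (x 0 0 * x 1 1 - q⁻¹ • (x 0 1 * x 1 0)) * t = 1

/-- A matrix `z` and an element `τ` of a `k`-algebra satisfying the defining relations of
`GL_q(2,-2)`. -/
structure IsGLq22Point (q : k) (z : Fin 2 → Fin 2 → A) (τ : A) : Prop where
  row₀ : z 0 1 * z 0 0 = -(q • (z 0 0 * z 0 1))
  col₀ : z 1 0 * z 0 0 = q • (z 0 0 * z 1 0)
  col₁ : z 1 1 * z 0 1 = q • (z 0 1 * z 1 1)
  row₁ : z 1 1 * z 1 0 = -(q • (z 1 0 * z 1 1))
  antidiag : z 0 1 * z 1 0 = -(z 1 0 * z 0 1)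
  diag : z 0 0 * z 1 1 + z 1 1 * z 0 0 = (q - q⁻¹) • (z 0 1 * z 1 0)
  anticomm : ∀ i j, z i j * τ = -(τ * z i j)
  det : (z 0 0 * z 1 1 + q⁻¹ • (z 0 1 * z 1 0)) * τ = 1

theorem isGLq2Point_generators (k : Type) [Field k] (q : k) :
    IsGLq2Point q (xM k q) (tE k q) := by
  constructor
  case comm =>
    intro i j
    fin_cases i <;> fin_cases j
    · simpa [xM, tE] using RingQuot.mkAlgHom_rel k (GLq2Rel.r7 (k := k) (q := q))
    · simpa [xM, tE] using RingQuot.mkAlgHom_rel k (GLq2Rel.r9 (k := k) (q := q))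
    · simpa [xM, tE] using RingQuot.mkAlgHom_rel k (GLq2Rel.r10 (k := k) (q := q))
    · simpa [xM, tE] using RingQuot.mkAlgHom_rel k (GLq2Rel.r8 (k := k) (q := q))
  · simpa [xM] using RingQuot.mkAlgHom_rel k (GLq2Rel.r1 (k := k) (q := q))
  · simpa [xM] using RingQuot.mkAlgHom_rel k (GLq2Rel.r2 (k := k) (q := q))
  · simpa [xM] using RingQuot.mkAlgHom_rel k (GLq2Rel.r3 (k := k) (q := q))
  · simpa [xM] using RingQuot.mkAlgHom_rel k (GLq2Rel.r4 (k := k) (q := q))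
  · simpa [xM] using RingQuot.mkAlgHom_rel k (GLq2Rel.r5 (k := k) (q := q))
  · simpa [xM] using RingQuot.mkAlgHom_rel k (GLq2Rel.r6 (k := k) (q := q))
  · simpa [xM, tE] using RingQuot.mkAlgHom_rel k (GLq2Rel.r11 (k := k) (q := q))

theorem isGLq22Point_generators (k : Type) [Field k] (q : k) :
    IsGLq22Point q (zM k q) (tauE k q) := by
  constructor
  case anticomm =>
    intro i j
    fin_cases i <;> fin_cases j
    · simpa [zM, tauE] using RingQuot.mkAlgHom_rel k (GLq22Rel.r7 (k := k) (q := q))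
    · simpa [zM, tauE] using RingQuot.mkAlgHom_rel k (GLq22Rel.r9 (k := k) (q := q))
    · simpa [zM, tauE] using RingQuot.mkAlgHom_rel k (GLq22Rel.r10 (k := k) (q := q))
    · simpa [zM, tauE] using RingQuot.mkAlgHom_rel k (GLq22Rel.r8 (k := k) (q := q))
  · simpa [zM] using RingQuot.mkAlgHom_rel k (GLq22Rel.r1 (k := k) (q := q))
  · simpa [zM] using RingQuot.mkAlgHom_rel k (GLq22Rel.r2 (k := k) (q := q))
  · simpa [zM] using RingQuot.mkAlgHom_rel k (GLq22Rel.r3 (k := k) (q := q))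
  · simpa [zM] using RingQuot.mkAlgHom_rel k (GLq22Rel.r4 (k := k) (q := q))
  · simpa [zM] using RingQuot.mkAlgHom_rel k (GLq22Rel.r5 (k := k) (q := q))
  · simpa [zM] using RingQuot.mkAlgHom_rel k (GLq22Rel.r6 (k := k) (q := q))
  · simpa [zM, tauE] using RingQuot.mkAlgHom_rel k (GLq22Rel.r11 (k := k) (q := q))

/-- The universal property of `GL_q(2)`. -/
theorem IsGLq2Point.exists_algHom {x : Fin 2 → Fin 2 → A} {t : A} (h : IsGLq2Point q x t) :
    ∃ f : GLq2 k q →ₐ[k] A, (∀ i j, f (xM k q i j) = x i j) ∧ f (tE k q) = t := by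
  let g : XGen → A
    | .x11 => x 0 0
    | .x12 => x 0 1
    | .x21 => x 1 0
    | .x22 => x 1 1
    | .t => t
  have hg : ∀ ⦃a b⦄, GLq2Rel k q a b → FreeAlgebra.lift k g a = FreeAlgebra.lift k g b := by
    intro a b hab
    cases hab <;> simp only [Xf, map_mul, map_smul, map_sub, map_one, FreeAlgebra.lift_ι_apply, g]
    exacts [h.row₀, h.col₀, h.col₁, h.row₁, h.antidiag, h.diag, h.comm 0 0, h.comm 1 1,
      h.comm 0 1, h.comm 1 0, h.det]
  refine ⟨RingQuot.liftAlgHom k ⟨FreeAlgebra.lift k g, hg⟩, fun i j => ?_, ?_⟩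
  · fin_cases i <;> fin_cases j <;> simp [xM, Xf, g]
  · simp [tE, Xf, g]

/-- The universal property of `GL_q(2,-2)`. -/
theorem IsGLq22Point.exists_algHom {z : Fin 2 → Fin 2 → A} {τ : A} (h : IsGLq22Point q z τ) :
    ∃ f : GLq22 k q →ₐ[k] A, (∀ i j, f (zM k q i j) = z i j) ∧ f (tauE k q) = τ := by
  let g : ZGen → A
    | .z11 => z 0 0
    | .z12 => z 0 1
    | .z21 => z 1 0
    | .z22 => z 1 1
    | .tau => τ
  have hg : ∀ ⦃a b⦄, GLq22Rel k q a b → FreeAlgebra.lift k g a = FreeAlgebra.lift k g b := by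
    intro a b hab
    cases hab <;> simp only [Zf, map_mul, map_smul, map_add, map_neg, map_one,
      FreeAlgebra.lift_ι_apply, g]
    exacts [h.row₀, h.col₀, h.col₁, h.row₁, h.antidiag, h.diag, h.anticomm 0 0,
      h.anticomm 1 1, h.anticomm 0 1, h.anticomm 1 0, h.det]
  refine ⟨RingQuot.liftAlgHom k ⟨FreeAlgebra.lift k g, hg⟩, fun i j => ?_, ?_⟩
  · fin_cases i <;> fin_cases j <;> simp [zM, Zf, g]
  · simp [tauE, Zf, g]

theorem GLq22.algHom_ext {C : Type*} [Semiring C] [Algebra k C]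
    {f g : GLq22 k q →ₐ[k] C}
    (hz : ∀ i j, f (zM k q i j) = g (zM k q i j)) (hτ : f (tauE k q) = g (tauE k q)) :
    f = g := by
  refine RingQuot.ringQuot_ext' k f g (FreeAlgebra.hom_ext (funext fun a => ?_))
  cases a
  exacts [hz 0 0, hz 0 1, hz 1 0, hz 1 1, hτ]

theorem IsGLq2Point.diag_swap {x : Fin 2 → Fin 2 → A} {t : A} (h : IsGLq2Point q x t) :
    x 1 1 * x 0 0 = x 0 0 * x 1 1 - (q⁻¹ - q) • (x 0 1 * x 1 0) := by
  rw [← h.diag, sub_sub_cancel]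

theorem IsGLq22Point.antidiag_swap {z : Fin 2 → Fin 2 → A} {τ : A} (h : IsGLq22Point q z τ) :
    z 1 0 * z 0 1 = -(z 0 1 * z 1 0) := by
  rw [h.antidiag, neg_neg]

theorem IsGLq22Point.diag_swap {z : Fin 2 → Fin 2 → A} {τ : A} (h : IsGLq22Point q z τ) :
    z 1 1 * z 0 0 = (q - q⁻¹) • (z 0 1 * z 1 0) - z 0 0 * z 1 1 := by
  rw [← h.diag, add_sub_cancel_left]

theorem isGLq2Point_one : IsGLq2Point q (fun i j => if i = j then (1 : k) else 0) 1 := by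
  constructor <;> simp

/-- The quantum determinant of a product of a matrix and a `GL_q(2)`-point with
mutually commuting entries. -/
theorem IsGLq2Point.det_tmul (hq : q ≠ 0) (x : Fin 2 → Fin 2 → A)
    {y : Fin 2 → Fin 2 → B} {s : B} (hy : IsGLq2Point q y s) :
    (∑ l, x 0 l ⊗ₜ[k] y l 0) * (∑ l, x 1 l ⊗ₜ[k] y l 1) -
        q⁻¹ • ((∑ l, x 0 l ⊗ₜ[k] y l 1) * (∑ l, x 1 l ⊗ₜ[k] y l 0)) =
      (x 0 0 * x 1 1 - q⁻¹ • (x 0 1 * x 1 0)) ⊗ₜ[k]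
        (y 0 0 * y 1 1 - q⁻¹ • (y 0 1 * y 1 0)) := by
  simp only [Fin.sum_univ_two, add_mul, mul_add, Algebra.TensorProduct.tmul_mul_tmul,
    hy.row₀, hy.row₁, ← hy.antidiag, hy.diag_swap, TensorProduct.sub_tmul,
    TensorProduct.tmul_sub,
    TensorProduct.tmul_smul, ← TensorProduct.smul_tmul']
  match_scalars <;> field_simp <;> ring

theorem IsGLq2Point.tmul (hq : q ≠ 0) {x : Fin 2 → Fin 2 → A} {t : A}
    {y : Fin 2 → Fin 2 → B} {s : B} (hx : IsGLq2Point q x t) (hy : IsGLq2Point q y s) :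
    IsGLq2Point q (fun i j => ∑ l, x i l ⊗ₜ[k] y l j) (t ⊗ₜ[k] s) := by
  constructor
  case comm =>
    intro i j
    simp [add_mul, mul_add, hx.comm, hy.comm]
  case det =>
    rw [hy.det_tmul hq x, Algebra.TensorProduct.tmul_mul_tmul, hx.det, hy.det,
      Algebra.TensorProduct.one_def]
  all_goals
    simp only [Fin.sum_univ_two, add_mul, mul_add, Algebra.TensorProduct.tmul_mul_tmul,
      hx.row₀, hx.col₀, hx.col₁, hx.row₁, ← hx.antidiag, hx.diag_swap,
      hy.row₀, hy.col₀, hy.col₁, hy.row₁, ← hy.antidiag, hy.diag_swap,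
      TensorProduct.sub_tmul, TensorProduct.tmul_sub,
      TensorProduct.tmul_smul, ← TensorProduct.smul_tmul']
    match_scalars <;> field_simp <;> ring

/-- The quantum determinant of the product of a matrix and a `GL_q(2,-2)`-point
with mutually commuting entries. -/
theorem IsGLq22Point.det_tmul (hq : q ≠ 0) (x : Fin 2 → Fin 2 → A)
    {z : Fin 2 → Fin 2 → B} {τ : B} (hz : IsGLq22Point q z τ) :
    (∑ l, x 0 l ⊗ₜ[k] z l 0) * (∑ l, x 1 l ⊗ₜ[k] z l 1) +
        q⁻¹ • ((∑ l, x 0 l ⊗ₜ[k] z l 1) * (∑ l, x 1 l ⊗ₜ[k] z l 0)) =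
      (x 0 0 * x 1 1 - q⁻¹ • (x 0 1 * x 1 0)) ⊗ₜ[k]
        (z 0 0 * z 1 1 + q⁻¹ • (z 0 1 * z 1 0)) := by
  simp only [Fin.sum_univ_two, add_mul, mul_add, Algebra.TensorProduct.tmul_mul_tmul,
    hz.row₀, hz.row₁, hz.antidiag_swap, hz.diag_swap, TensorProduct.sub_tmul,
    TensorProduct.tmul_add, TensorProduct.tmul_sub, TensorProduct.tmul_neg,
    TensorProduct.tmul_smul, ← TensorProduct.smul_tmul']
  match_scalars <;> field_simp <;> ring

theorem IsGLq22Point.tmul (hq : q ≠ 0) {x : Fin 2 → Fin 2 → A} {t : A}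
    {z : Fin 2 → Fin 2 → B} {τ : B} (hx : IsGLq2Point q x t) (hz : IsGLq22Point q z τ) :
    IsGLq22Point q (fun i j => ∑ l, x i l ⊗ₜ[k] z l j) (t ⊗ₜ[k] τ) := by
  constructor
  case anticomm =>
    intro i j
    simp [add_mul, mul_add, hx.comm, hz.anticomm, TensorProduct.tmul_neg, add_comm]
  case det =>
    rw [hz.det_tmul hq x, Algebra.TensorProduct.tmul_mul_tmul, hx.det, hz.det,
      Algebra.TensorProduct.one_def]
  all_goals
    simp only [Fin.sum_univ_two, add_mul, mul_add, Algebra.TensorProduct.tmul_mul_tmul,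
      hx.row₀, hx.col₀, hx.col₁, hx.row₁, ← hx.antidiag, hx.diag_swap,
      hz.row₀, hz.col₀, hz.col₁, hz.row₁, hz.antidiag_swap, hz.diag_swap,
      TensorProduct.sub_tmul, TensorProduct.tmul_sub, TensorProduct.tmul_neg,
      TensorProduct.tmul_smul, ← TensorProduct.smul_tmul']
    match_scalars <;> field_simp <;> ring

end Points

/-- There is an algebra homomorphism
`α : GL_q(2,-2) → GL_q(2) ⊗ GL_q(2,-2)` with `α(z_{ij}) = Σ_l x_{il} ⊗ z_{lj}` and
`α(τ) = t ⊗ τ`, making `GL_q(2,-2)` a left `GL_q(2)`-comodule algebra, where the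
comultiplication `Δ` and counit `ε` of `GL_q(2)` are determined by
`Δ(x_{ij}) = Σ_l x_{il} ⊗ x_{lj}`, `Δ(t) = t ⊗ t`, `ε(x_{ij}) = δ_{ij}`, `ε(t) = 1`. -/
theorem GLq22_comodule_algebra
    (k : Type) [Field k] (q : k) (hq : q ≠ 0) :
    ∃ (Δ : GLq2 k q →ₐ[k] GLq2 k q ⊗[k] GLq2 k q) (ε : GLq2 k q →ₐ[k] k)
      (α : GLq22 k q →ₐ[k] GLq2 k q ⊗[k] GLq22 k q),
      (∀ i j : Fin 2, Δ (xM k q i j) = ∑ l : Fin 2, xM k q i l ⊗ₜ[k] xM k q l j) ∧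
      Δ (tE k q) = tE k q ⊗ₜ[k] tE k q ∧
      (∀ i j : Fin 2, ε (xM k q i j) = if i = j then 1 else 0) ∧
      ε (tE k q) = 1 ∧
      (∀ i j : Fin 2, α (zM k q i j) = ∑ l : Fin 2, xM k q i l ⊗ₜ[k] zM k q l j) ∧
      α (tauE k q) = tE k q ⊗ₜ[k] tauE k q ∧
      (Algebra.TensorProduct.assoc k k k (GLq2 k q) (GLq2 k q) (GLq22 k q)).toAlgHom.comp
          ((Algebra.TensorProduct.map Δ (AlgHom.id k (GLq22 k q))).comp α) =
        (Algebra.TensorProduct.map (AlgHom.id k (GLq2 k q)) α).comp α ∧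
      (Algebra.TensorProduct.lid k (GLq22 k q)).toAlgHom.comp
          ((Algebra.TensorProduct.map ε (AlgHom.id k (GLq22 k q))).comp α) =
        AlgHom.id k (GLq22 k q) := by
  have hX := isGLq2Point_generators k q
  have hZ := isGLq22Point_generators k q
  obtain ⟨Δ, hΔx, hΔt⟩ := (hX.tmul hq hX).exists_algHom
  obtain ⟨ε, hεx, hεt⟩ := (isGLq2Point_one (q := q)).exists_algHom
  obtain ⟨α, hαz, hατ⟩ := (IsGLq22Point.tmul hq hX hZ).exists_algHom
  refine ⟨Δ, ε, α, hΔx, hΔt, hεx, hεt, hαz, hατ, GLq22.algHom_ext (fun i j => ?_) ?_,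
    GLq22.algHom_ext (fun i j => ?_) ?_⟩
  · simp [hαz, hΔx, TensorProduct.add_tmul, TensorProduct.tmul_add, add_add_add_comm]
  · simp [hατ, hΔt]
  · fin_cases i <;> simp [hαz, hεx]
  · simp [hατ, hεt]

end
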